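/- arXiv:2211.03822 — 7 statements merged into one kernel-verified Lean document; each statement's English description precedes it below -/
import Mathlib

section
/- Let X be an n×n complex matrix whose spectral radius is at most 1 (i.e. every complex eigenvalue z of X satisfies |z| ≤ 1). Then the set of bounded X-harmonic sequences coincides with the ℂ-linear span of the elementary sequences k ↦ λ^{-k} • a, where λ ranges over the eigenvalues of X with |λ| = 1 and a over corresponding eigenvectors (X·a = λ·a). -/
open Polynomial in
/-- An endomorphism annihilated by a monic split polynomial, all of whose generalized eigenvectors
of order two are eigenvectors, is diagonalizable. -/
theorem Module.End.iSup_eigenspace_eq_top_of_aeval_eq_zero {K M : Type*} [Field K]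
    [AddCommGroup M] [Module K M] (T : Module.End K M) {p : K[X]} (hp : p.Monic)
    (hs : p.Splits) (hT : aeval T p = 0)
    (h : ∀ (μ : K) (x : M), T x - μ • x ∈ T.eigenspace μ → x ∈ T.eigenspace μ) :
    ⨆ μ, T.eigenspace μ = ⊤ := by
  have lift (μ : K) (y : M) (hy : y ∈ ⨆ ν, T.eigenspace ν) :
      ∃ z ∈ ⨆ ν, T.eigenspace ν, y - (T z - μ • z) ∈ T.eigenspace μ := by
    induction hy using Submodule.iSup_induction' with
    | mem ν y hy =>
      by_cases hνμ : ν = μ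
      · subst hνμ
        exact ⟨0, zero_mem _, by simpa using hy⟩
      · refine ⟨(ν - μ)⁻¹ • y,
          Submodule.mem_iSup_of_mem ν (Submodule.smul_mem _ _ hy), ?_⟩
        have hT : T ((ν - μ)⁻¹ • y) - μ • (ν - μ)⁻¹ • y = y := by
          rw [map_smul, Module.End.mem_eigenspace_iff.1 hy, smul_comm μ, ← smul_sub, ← sub_smul,
            inv_smul_smul₀ (sub_ne_zero.2 hνμ)]
        rw [hT, sub_self]
        exact zero_mem _
    | zero => exact ⟨0, zero_mem _, by simp⟩
    | add y₁ y₂ _ _ h₁ h₂ =>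
      obtain ⟨z₁, hz₁, h₁⟩ := h₁
      obtain ⟨z₂, hz₂, h₂⟩ := h₂
      refine ⟨z₁ + z₂, add_mem hz₁ hz₂, ?_⟩
      convert add_mem h₁ h₂ using 1
      rw [map_add, smul_add]
      abel
  have key (s : Multiset K) (x : M) (hx : aeval T (s.map fun a => X - C a).prod x = 0) :
      x ∈ ⨆ ν, T.eigenspace ν := by
    induction s using Multiset.induction_on generalizing x with
    | empty =>
      have hx0 : x = 0 := by simpa using hx
      exact hx0 ▸ zero_mem _
    | cons μ s ih =>
      rw [Multiset.map_cons, Multiset.prod_cons, mul_comm, map_mul, Module.End.mul_apply] at hx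
      obtain ⟨z, hz, hyz⟩ := lift μ (T x - μ • x) (ih _ (by simpa using hx))
      have hxz : x - z ∈ T.eigenspace μ := by
        apply h
        convert hyz using 1
        rw [map_sub, smul_sub]
        abel
      simpa using add_mem (Submodule.mem_iSup_of_mem μ hxz) hz
  rw [eq_top_iff]
  intro x _
  apply key p.roots
  rw [← hs.eq_prod_roots_of_monic hp, hT, LinearMap.zero_apply]

namespace Matrix

variable {n : ℕ} (X : Matrix (Fin n) (Fin n) ℂ)

/-- The space of bounded `X`-harmonic sequences. -/
def boundedHarmonic : Submodule ℂ (ℕ → Fin n → ℂ) where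
  carrier := {x | (∀ k, X.mulVec (x (k + 1)) = x k) ∧ ∃ C : ℝ, ∀ k, ‖x k‖ ≤ C}
  zero_mem' := ⟨fun k => by simp, 0, fun k => by simp⟩
  add_mem' := by
    rintro x y ⟨hx, C, hC⟩ ⟨hy, D, hD⟩
    exact ⟨fun k => by simp [mulVec_add, hx, hy], C + D,
      fun k => (norm_add_le _ _).trans (add_le_add (hC k) (hD k))⟩
  smul_mem' := by
    rintro c x ⟨hx, C, hC⟩
    refine ⟨fun k => by simp [mulVec_smul, hx], ‖c‖ * C, fun k => ?_⟩
    rw [Pi.smul_apply, norm_smul]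
    exact mul_le_mul_of_nonneg_left (hC k) (norm_nonneg c)

variable {X}

theorem mulVec_mem_boundedHarmonic {x : ℕ → Fin n → ℂ} (hx : x ∈ X.boundedHarmonic) :
    (fun k => X.mulVec (x k)) ∈ X.boundedHarmonic := by
  obtain ⟨hx, C, hC⟩ := hx
  refine ⟨fun k => congrArg X.mulVec (hx k), max C ‖X.mulVec (x 0)‖, ?_⟩
  rintro (_ | k)
  · exact le_max_right _ _
  · simp only [hx]
    exact (hC k).trans (le_max_left _ _)

variable (X) in
/-- The action of `X` on bounded `X`-harmonic sequences. -/
def boundedHarmonicEnd : Module.End ℂ X.boundedHarmonic where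
  toFun x := ⟨fun k => X.mulVec (x.1 k), mulVec_mem_boundedHarmonic x.2⟩
  map_add' x y := by ext1; funext k; exact mulVec_add X (x.1 k) (y.1 k)
  map_smul' c x := by ext1; funext k; exact mulVec_smul X c (x.1 k)

theorem boundedHarmonicEnd_apply (x : X.boundedHarmonic) (k : ℕ) :
    (X.boundedHarmonicEnd x).1 k = X.mulVec (x.1 k) := rfl

open Polynomial in
theorem aeval_boundedHarmonicEnd_apply (p : ℂ[X]) (x : X.boundedHarmonic) (k : ℕ) :
    (aeval X.boundedHarmonicEnd p x).1 k = (aeval X p).mulVec (x.1 k) := by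
  induction p using Polynomial.induction_on' generalizing x with
  | add p q hp hq => simp [add_mulVec, hp, hq]
  | monomial m c =>
    have hpow : ((X.boundedHarmonicEnd ^ m) x).1 k = (X ^ m).mulVec (x.1 k) := by
      induction m generalizing x with
      | zero => simp
      | succ m ih =>
        rw [pow_succ, pow_succ, Module.End.mul_apply, ih, boundedHarmonicEnd_apply, mulVec_mulVec]
    simp [aeval_monomial, Algebra.algebraMap_eq_smul_one, smul_mulVec, hpow]

theorem mem_eigenspace_boundedHarmonicEnd {μ : ℂ} {x : X.boundedHarmonic} :
    x ∈ X.boundedHarmonicEnd.eigenspace μ ↔ ∀ k, X.mulVec (x.1 k) = μ • x.1 k := by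
  rw [Module.End.mem_eigenspace_iff, Subtype.ext_iff, funext_iff]
  rfl

theorem eq_pow_smul_of_mem_eigenspace {μ : ℂ} {x : X.boundedHarmonic}
    (hx : x ∈ X.boundedHarmonicEnd.eigenspace μ) (j m : ℕ) :
    x.1 j = μ ^ m • x.1 (j + m) := by
  induction m with
  | zero => simp
  | succ m ih =>
    rw [ih, pow_succ, mul_smul, ← mem_eigenspace_boundedHarmonicEnd.1 hx, ← add_assoc, x.2.1]

/-- Eigenvalues of `X` on bounded harmonic sequences have modulus at least one. -/
theorem one_le_norm_of_mem_eigenspace {μ : ℂ} {x : X.boundedHarmonic}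
    (hx : x ∈ X.boundedHarmonicEnd.eigenspace μ) (hx0 : x ≠ 0) : 1 ≤ ‖μ‖ := by
  contrapose! hx0
  obtain ⟨C, hC⟩ := x.2.2
  ext1
  funext j
  have hlim : Filter.Tendsto (fun m : ℕ => ‖μ‖ ^ m * C) Filter.atTop (nhds 0) := by
    simpa using (tendsto_pow_atTop_nhds_zero_of_lt_one (norm_nonneg μ) hx0).mul_const C
  refine norm_le_zero_iff.1 (ge_of_tendsto' hlim fun m => ?_)
  rw [eq_pow_smul_of_mem_eigenspace hx j m, norm_smul, norm_pow]
  exact mul_le_mul_of_nonneg_left (hC _) (by positivity)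

theorem norm_eq_one_of_mem_eigenspace
    (hX : ∀ z : ℂ, (∃ v : Fin n → ℂ, v ≠ 0 ∧ X.mulVec v = z • v) → ‖z‖ ≤ 1)
    {μ : ℂ} {x : X.boundedHarmonic}
    (hx : x ∈ X.boundedHarmonicEnd.eigenspace μ) (hx0 : x ≠ 0) : ‖μ‖ = 1 := by
  refine le_antisymm ?_ (one_le_norm_of_mem_eigenspace hx hx0)
  obtain ⟨k, hk⟩ : ∃ k, x.1 k ≠ 0 := by
    contrapose! hx0
    exact Subtype.ext (funext hx0)
  exact hX μ ⟨x.1 k, hk, mem_eigenspace_boundedHarmonicEnd.1 hx k⟩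

/-- A generalized eigenvector of order two among bounded harmonic sequences is an eigenvector. -/
theorem mem_eigenspace_of_sub_smul_mem_eigenspace
    (hX : ∀ z : ℂ, (∃ v : Fin n → ℂ, v ≠ 0 ∧ X.mulVec v = z • v) → ‖z‖ ≤ 1)
    (μ : ℂ) (z : X.boundedHarmonic)
    (hz : X.boundedHarmonicEnd z - μ • z ∈ X.boundedHarmonicEnd.eigenspace μ) :
    z ∈ X.boundedHarmonicEnd.eigenspace μ := by
  rw [Module.End.mem_eigenspace_iff, ← sub_eq_zero]
  set w := X.boundedHarmonicEnd z - μ • z with hw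
  by_contra hw0
  have hμ := norm_eq_one_of_mem_eigenspace hX hz hw0
  have hμ0 : μ ≠ 0 := norm_ne_zero_iff.1 (by rw [hμ]; exact one_ne_zero)
  have step (k : ℕ) : z.1 k = μ • z.1 (k + 1) + w.1 (k + 1) := by
    have : w.1 (k + 1) = X.mulVec (z.1 (k + 1)) - μ • z.1 (k + 1) := rfl
    rw [this, z.2.1]
    abel
  have expand (j m : ℕ) : z.1 j = μ ^ m • z.1 (j + m) + (m : ℂ) • μ⁻¹ • w.1 j := by
    induction m with
    | zero => simp
    | succ m ih =>
      have hwj : μ⁻¹ • w.1 j = μ ^ m • w.1 (j + m + 1) := by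
        rw [eq_pow_smul_of_mem_eigenspace hz j (m + 1), pow_succ', mul_smul,
          inv_smul_smul₀ hμ0, add_assoc]
      conv_lhs => rw [ih, step (j + m)]
      rw [smul_add, ← hwj, pow_succ, mul_smul, Nat.cast_succ, add_smul, one_smul, ← add_assoc j]
      abel
  obtain ⟨C, hC⟩ := z.2.2
  refine hw0 (Subtype.ext (funext fun j => ?_))
  by_contra hj
  have hpos : 0 < ‖w.1 j‖ := norm_pos_iff.2 hj
  obtain ⟨m, hm⟩ := exists_nat_gt (2 * C / ‖w.1 j‖)
  rw [div_lt_iff₀ hpos] at hm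
  have hmw : (m : ℂ) • μ⁻¹ • w.1 j = z.1 j - μ ^ m • z.1 (j + m) :=
    eq_sub_of_add_eq' (expand j m).symm
  have hnorm := norm_sub_le (z.1 j) (μ ^ m • z.1 (j + m))
  rw [← hmw, norm_smul, norm_smul, norm_smul, norm_inv, norm_pow, hμ, inv_one, one_pow, one_mul,
    one_mul, Complex.norm_natCast] at hnorm
  linarith [hC j, hC (j + m)]

theorem iSup_eigenspace_boundedHarmonicEnd_eq_top
    (hX : ∀ z : ℂ, (∃ v : Fin n → ℂ, v ≠ 0 ∧ X.mulVec v = z • v) → ‖z‖ ≤ 1) :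
    ⨆ μ, X.boundedHarmonicEnd.eigenspace μ = ⊤ := by
  refine Module.End.iSup_eigenspace_eq_top_of_aeval_eq_zero _ X.charpoly_monic
    (IsAlgClosed.splits _) ?_ (mem_eigenspace_of_sub_smul_mem_eigenspace hX)
  ext1 x
  ext1
  funext k
  rw [aeval_boundedHarmonicEnd_apply, aeval_self_charpoly, zero_mulVec]
  rfl

end Matrix

/-- For an `n × n` complex matrix `X` with spectral radius at most `1`,
the set of bounded `X`-harmonic sequences coincides with the `ℂ`-linear span of the
elementary sequences `k ↦ λ⁻ᵏ • a` where `‖λ‖ = 1` and `X.mulVec a = λ • a`. -/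
theorem bounded_harmonic_eq_span_elementary (n : ℕ) (X : Matrix (Fin n) (Fin n) ℂ)
    (hX : ∀ z : ℂ, (∃ v : Fin n → ℂ, v ≠ 0 ∧ X.mulVec v = z • v) → ‖z‖ ≤ 1) :
    {x : ℕ → Fin n → ℂ |
        (∀ k : ℕ, X.mulVec (x (k + 1)) = x k) ∧ ∃ C : ℝ, ∀ k : ℕ, ‖x k‖ ≤ C} =
      (Submodule.span ℂ
        {s : ℕ → Fin n → ℂ |
          ∃ (l : ℂ) (a : Fin n → ℂ), ‖l‖ = 1 ∧ X.mulVec a = l • a ∧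
            s = fun k : ℕ => l⁻¹ ^ k • a} : Set (ℕ → Fin n → ℂ)) := by
  change (X.boundedHarmonic : Set (ℕ → Fin n → ℂ)) = _
  refine congrArg _ (le_antisymm (fun x hx => ?_) (Submodule.span_le.2 ?_))
  · have hmem : (⟨x, hx⟩ : X.boundedHarmonic) ∈ ⨆ μ, X.boundedHarmonicEnd.eigenspace μ := by
      rw [Matrix.iSup_eigenspace_boundedHarmonicEnd_eq_top hX]
      exact Submodule.mem_top
    suffices hspan : ⨆ μ, X.boundedHarmonicEnd.eigenspace μ ≤
        (Submodule.span ℂ _).comap X.boundedHarmonic.subtype from hspan hmem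
    refine iSup_le fun μ y hy => ?_
    by_cases hy0 : y = 0
    · rw [hy0]
      exact zero_mem _
    have hμ := Matrix.norm_eq_one_of_mem_eigenspace hX hy hy0
    have hμ0 : μ ≠ 0 := norm_ne_zero_iff.1 (by rw [hμ]; exact one_ne_zero)
    refine Submodule.subset_span
      ⟨μ, y.1 0, hμ, Matrix.mem_eigenspace_boundedHarmonicEnd.1 hy 0, funext fun k => ?_⟩
    rw [Matrix.eq_pow_smul_of_mem_eigenspace hy 0 k, zero_add, inv_pow,
      inv_smul_smul₀ (pow_ne_zero k hμ0)]
    rfl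
  · rintro _ ⟨l, a, hl, ha, rfl⟩
    have hl0 : l ≠ 0 := norm_ne_zero_iff.1 (by rw [hl]; exact one_ne_zero)
    refine ⟨fun k => ?_, ‖a‖, fun k => ?_⟩
    · rw [Matrix.mulVec_smul, ha, pow_succ, mul_smul, inv_smul_smul₀ hl0]
    · rw [norm_smul, norm_pow, norm_inv, hl, inv_one, one_pow, one_mul]
end

section
/- Let E be a finite-dimensional complex inner product space and f : E → E a ℂ-linear map with ‖f(v)‖ ≤ ‖v‖ for all v ∈ E. Then every bounded f-harmonic sequence lies in the ℂ-linear span of the elementary sequences k ↦ λ^{-k} • v, where λ ranges over the eigenvalues of f with |λ| = 1 and v over corresponding eigenvectors (f(v) = λ·v). -/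
open Filter Topology in
/-- In a complex Banach algebra, the powers of an element of spectral radius less than one
tend to zero in norm. -/
theorem tendsto_norm_pow_of_spectralRadius_lt_one {A : Type*} [NormedRing A] [NormedAlgebra ℂ A]
    [CompleteSpace A] {a : A} (ha : spectralRadius ℂ a < 1) :
    Tendsto (fun n : ℕ => ‖a ^ n‖) atTop (𝓝 0) := by
  obtain ⟨r, har, hr⟩ := ENNReal.lt_iff_exists_nnreal_btwn.mp ha
  have hr1 : r < 1 := by exact_mod_cast hr
  have hlt := (spectrum.pow_nnnorm_pow_one_div_tendsto_nhds_spectralRadius a).eventually_lt_const har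
  refine squeeze_zero' (Eventually.of_forall fun n => norm_nonneg _) ?_
    (tendsto_pow_atTop_nhds_zero_of_lt_one r.coe_nonneg (by exact_mod_cast hr1))
  filter_upwards [hlt, eventually_gt_atTop 0] with n hn hpos
  have hn0 : (n : ℝ) ≠ 0 := by positivity
  have h := ENNReal.rpow_le_rpow hn.le (Nat.cast_nonneg (α := ℝ) n)
  rw [← ENNReal.rpow_mul, one_div_mul_cancel hn0, ENNReal.rpow_one, ENNReal.rpow_natCast] at h
  exact_mod_cast h

/-- A bounded harmonic sequence of a linear contraction of a finite-dimensional complex normed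
space without eigenvalues of modulus one vanishes. -/
theorem bounded_harmonic_eq_zero {E : Type*} [NormedAddCommGroup E] [NormedSpace ℂ E]
    [FiniteDimensional ℂ E] (f : E →ₗ[ℂ] E) (hf : ∀ v : E, ‖f v‖ ≤ ‖v‖)
    (hev : ∀ (l : ℂ) (v : E), ‖l‖ = 1 → f v = l • v → v = 0)
    {x : ℕ → E} (hharm : ∀ k : ℕ, f (x (k + 1)) = x k)
    {C : ℝ} (hC : ∀ k : ℕ, ‖x k‖ ≤ C) : x = 0 := by
  cases subsingleton_or_nontrivial E
  · exact Subsingleton.elim _ _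
  have := FiniteDimensional.complete ℂ E
  set F : E →L[ℂ] E := LinearMap.toContinuousLinearMap f
  have hFf : ∀ v, F v = f v := fun _ => rfl
  have hrad : spectralRadius ℂ F < 1 := by
    refine spectrum.spectralRadius_lt_of_forall_lt F fun l hl => ?_
    rw [ContinuousLinearMap.spectrum_eq] at hl
    obtain ⟨v, hv⟩ := (Module.End.hasEigenvalue_iff_mem_spectrum.mpr hl).exists_hasEigenvector
    have hfv : f v = l • v := hv.apply_eq_smul
    have hle : ‖l‖ * ‖v‖ ≤ 1 * ‖v‖ := by
      rw [← norm_smul, ← hfv, one_mul]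
      exact hf v
    have hl1 : ‖l‖ ≤ 1 := le_of_mul_le_mul_right hle (norm_pos_iff.mpr hv.2)
    have hne : ‖l‖ ≠ 1 := fun h => hv.2 (hev l v h hfv)
    exact_mod_cast lt_of_le_of_ne hl1 hne
  have hpow : ∀ n k : ℕ, (F ^ n) (x (k + n)) = x k := by
    intro n
    induction n with
    | zero => intro k; simp
    | succ n ih =>
      intro k
      rw [pow_succ, mul_apply_eq_comp, hFf, ← add_assoc, hharm, ih]
  funext k
  have hlim := (tendsto_norm_pow_of_spectralRadius_lt_one hrad).mul_const C
  rw [zero_mul] at hlim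
  refine norm_le_zero_iff.mp (ge_of_tendsto' hlim fun n => ?_)
  calc ‖x k‖ = ‖(F ^ n) (x (k + n))‖ := by rw [hpow]
    _ ≤ ‖F ^ n‖ * ‖x (k + n)‖ := (F ^ n).le_opNorm _
    _ ≤ ‖F ^ n‖ * C := by gcongr; exact hC _

/-- An eigenvector of a contraction for an eigenvalue of modulus one is also an eigenvector of the
adjoint. -/
theorem inner_apply_of_eigenvector_of_norm_one {E : Type*} [NormedAddCommGroup E]
    [InnerProductSpace ℂ E] [FiniteDimensional ℂ E] (f : E →ₗ[ℂ] E)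
    (hf : ∀ v : E, ‖f v‖ ≤ ‖v‖) {l : ℂ} {v : E} (hl : ‖l‖ = 1) (hfv : f v = l • v) (w : E) :
    inner ℂ v (f w) = l * inner ℂ v w := by
  have := FiniteDimensional.complete ℂ E
  set F : E →L[ℂ] E := LinearMap.toContinuousLinearMap f
  have hF : ‖F‖ ≤ 1 := F.opNorm_le_bound zero_le_one fun v => by rw [one_mul]; exact hf v
  have hv : ‖(starRingEnd ℂ) l • v‖ = ‖v‖ := by simp [norm_smul, hl]
  have hadj : F.adjoint v = (starRingEnd ℂ) l • v := by
    refine eq_of_norm_le_re_inner_eq_norm_sq (𝕜 := ℂ) ?_ ?_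
    · rw [hv]
      have hF' : ‖F.adjoint‖ ≤ 1 := by rwa [LinearIsometryEquiv.norm_map]
      simpa using F.adjoint.le_of_opNorm_le hF' v
    · rw [ContinuousLinearMap.adjoint_inner_left, map_smul, hv, show F v = l • v from hfv,
        smul_smul, Complex.conj_mul', hl, inner_smul_right, inner_self_eq_norm_sq_to_K]
      simp [← Complex.ofReal_pow]
  have h := F.adjoint_inner_left w v
  rw [hadj, inner_smul_left, Complex.conj_conj] at h
  exact h.symm

/-- If `f` is a linear contraction of a finite-dimensional complex inner
product space `E`, then every bounded `f`-harmonic sequence lies in the `ℂ`-span of the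
elementary sequences `k ↦ λ⁻ᵏ • v` where `‖λ‖ = 1` and `f v = λ • v`. -/
theorem bounded_harmonic_mem_span_elementary (E : Type*) [NormedAddCommGroup E]
    [InnerProductSpace ℂ E] [FiniteDimensional ℂ E]
    (f : E →ₗ[ℂ] E) (hf : ∀ v : E, ‖f v‖ ≤ ‖v‖)
    (x : ℕ → E) (hharm : ∀ k : ℕ, f (x (k + 1)) = x k)
    (hbdd : ∃ C : ℝ, ∀ k : ℕ, ‖x k‖ ≤ C) :
    x ∈ Submodule.span ℂ
      {s : ℕ → E |
        ∃ (l : ℂ) (v : E), ‖l‖ = 1 ∧ f v = l • v ∧ s = fun k : ℕ => l⁻¹ ^ k • v} := by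
  induction hn : Module.finrank ℂ E using Nat.strong_induction_on generalizing E with
  | _ n ih =>
  obtain ⟨C, hC⟩ := hbdd
  by_cases hev : ∀ (l : ℂ) (v : E), ‖l‖ = 1 → f v = l • v → v = 0
  · rw [bounded_harmonic_eq_zero f hf hev hharm hC]
    exact zero_mem _
  push Not at hev
  obtain ⟨l, u, hl, hfu, hu⟩ := hev
  obtain ⟨v, hv, hfv⟩ : ∃ v : E, ‖v‖ = 1 ∧ f v = l • v :=
    ⟨((‖u‖⁻¹ : ℝ) : ℂ) • u, by simp [norm_smul, hu], by rw [map_smul, hfu, smul_comm]⟩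
  have hl0 : l ≠ 0 := norm_ne_zero_iff.mp (by simp [hl])
  have hinner := inner_apply_of_eigenvector_of_norm_one f hf hl hfv
  have hvv : inner ℂ v v = 1 := by simp [inner_self_eq_norm_sq_to_K, hv]
  let K : Submodule ℂ E := (ℂ ∙ v)ᗮ
  have hK : ∀ w, w ∈ K ↔ inner ℂ v w = 0 := fun w =>
    Submodule.mem_orthogonal_singleton_iff_inner_right
  have hfK : ∀ w ∈ K, f w ∈ K := fun w hw => by
    rw [hK] at hw ⊢
    rw [hinner, hw, mul_zero]
  let c : ℕ → ℂ := fun k => inner ℂ v (x k)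
  have hc_succ : ∀ k, l * c (k + 1) = c k := fun k => by simp only [c, ← hinner, hharm]
  have hc : ∀ k, c k = l⁻¹ ^ k * c 0 := by
    intro k
    induction k with
    | zero => simp
    | succ k ihk => rw [pow_succ', mul_assoc, ← ihk, ← hc_succ k, inv_mul_cancel_left₀ hl0]
  let y : ℕ → K := fun k => ⟨x k - c k • v, by
    simp only [hK, c, inner_sub_right, inner_smul_right, hvv, mul_one, sub_self]⟩
  have hfin : Module.finrank ℂ K < n := by
    have h := (ℂ ∙ v).finrank_add_finrank_orthogonal
    rw [finrank_span_singleton (norm_ne_zero_iff.mp (by simp [hv])), hn] at h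
    change 1 + Module.finrank ℂ K = n at h
    omega
  have hy := ih _ hfin K (f.restrict hfK) (fun w => hf w) y
    (fun k => Subtype.ext <| by
      simp only [y, LinearMap.restrict_apply, map_sub, map_smul, hharm, hfv, smul_smul]
      rw [mul_comm, hc_succ])
    ⟨C + C, fun k => by
      refine (norm_sub_le (x k) (c k • v)).trans (add_le_add (hC k) ?_)
      rw [norm_smul, hv, mul_one]
      exact (norm_inner_le_norm v (x k)).trans (by rw [hv, one_mul]; exact hC k)⟩ rfl
  have hx : x = K.subtype.compLeft ℕ y + fun k => l⁻¹ ^ k • (c 0 • v) := by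
    funext k
    change x k = x k - c k • v + l⁻¹ ^ k • (c 0 • v)
    rw [smul_smul, ← hc, sub_add_cancel]
  rw [hx]
  refine add_mem ?_ (Submodule.subset_span
    ⟨l, c 0 • v, hl, by rw [map_smul, hfv, smul_comm], rfl⟩)
  refine Submodule.map_span_le (K.subtype.compLeft ℕ) _ _ |>.mpr ?_ (Submodule.mem_map_of_mem hy)
  rintro _ ⟨m, w, hm, hw, rfl⟩
  exact Submodule.subset_span ⟨m, w, hm, congrArg Subtype.val hw, rfl⟩
end

section
/- Let X and Y be nonempty finite sets and U a unitary complex matrix indexed by X × Y. The vertex-model loop operator S on M_Y(ℂ) associated to U is positive: if η ∈ M_Y(ℂ) is positive semidefinite, then Sη is positive semidefinite. -/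
open scoped Matrix ComplexOrder

/-- The vertex-model loop operator on `M_Y(ℂ)` associated to a matrix `U` indexed by
`X × Y`. -/
noncomputable def loopS {X Y : Type*} [Fintype X] [Fintype Y]
    (U : Matrix (X × Y) (X × Y) ℂ) (η : Matrix Y Y ℂ) : Matrix Y Y ℂ :=
  Matrix.of fun y y' =>
    (Fintype.card X : ℂ)⁻¹ *
      ∑ x₁ : X, ∑ x₂ : X, ∑ y₁ : Y, ∑ y₂ : Y,
        (starRingEnd ℂ) (U (x₁, y) (x₂, y₂)) * η y₂ y₁ * U (x₁, y') (x₂, y₁)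


/-- Kraus decomposition of the loop operator. -/
theorem loopS_eq_sum_conj {X Y : Type*} [Fintype X] [Fintype Y]
    (U : Matrix (X × Y) (X × Y) ℂ) (η : Matrix Y Y ℂ) :
    loopS U η = (Fintype.card X : ℂ)⁻¹ • ∑ x₁ : X, ∑ x₂ : X,
      (Matrix.of fun y y₂ => star (U (x₁, y) (x₂, y₂))) * η *
        (Matrix.of fun y y₂ => star (U (x₁, y) (x₂, y₂)))ᴴ := by
  ext y y'
  simp [loopS, Matrix.sum_apply, Matrix.mul_apply, Finset.sum_mul]

/-- The vertex-model loop operator associated to a unitary `U` is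
positive: it maps positive semidefinite matrices to positive semidefinite matrices. -/
theorem loopS_positive {X Y : Type*} [Fintype X] [Fintype Y] [DecidableEq X]
    [DecidableEq Y] [Nonempty X] [Nonempty Y] (U : Matrix (X × Y) (X × Y) ℂ)
    (hU : U ∈ Matrix.unitaryGroup (X × Y) ℂ) (η : Matrix Y Y ℂ)
    (hη : η.PosSemidef) : (loopS U η).PosSemidef := by
  rw [loopS_eq_sum_conj]
  refine Matrix.PosSemidef.smul ?_ (inv_nonneg.mpr (Nat.cast_nonneg _))
  exact Matrix.posSemidef_sum _ fun x₁ _ => Matrix.posSemidef_sum _ fun x₂ _ =>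
    hη.mul_mul_conjTranspose_same _
end

section
/- Let X and Y be nonempty finite sets and U a unitary complex matrix indexed by X × Y. The vertex-model loop operator S on M_Y(ℂ) associated to U satisfies the Kadison–Schwarz inequality: for every η ∈ M_Y(ℂ), the matrix S(ηᴴ·η) − (Sη)ᴴ·(Sη) is positive semidefinite. -/
open scoped Matrix ComplexOrder

/-- The Kadison–Schwarz inequality for a unital completely positive map in Kraus form. -/
theorem posSemidef_kraus_kadison_schwarz {ι m n : Type*} [Fintype ι] [Fintype m] [Fintype n]
    [DecidableEq m] (c : ℂ) (hc : 0 ≤ c) (K : ι → Matrix n m ℂ)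
    (hK : c • ∑ i, (K i)ᴴ * K i = 1) (η : Matrix n n ℂ) :
    ((c • ∑ i, (K i)ᴴ * (ηᴴ * η) * K i) -
      (c • ∑ i, (K i)ᴴ * η * K i)ᴴ * (c • ∑ i, (K i)ᴴ * η * K i)).PosSemidef := by
  set T := c • ∑ i, (K i)ᴴ * η * K i with hT
  have hc' : star c = c := (IsSelfAdjoint.of_nonneg hc).star_eq
  have hT' : Tᴴ = c • ∑ i, (K i)ᴴ * ηᴴ * K i := by
    simp [hT, Matrix.conjTranspose_sum, hc', Matrix.mul_assoc]
  have key : (c • ∑ i, (K i)ᴴ * (ηᴴ * η) * K i) - Tᴴ * T =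
      c • ∑ i, (η * K i - K i * T)ᴴ * (η * K i - K i * T) := by
    have expand : ∀ i, (η * K i - K i * T)ᴴ * (η * K i - K i * T) =
        (K i)ᴴ * (ηᴴ * η) * K i - (K i)ᴴ * ηᴴ * K i * T - Tᴴ * ((K i)ᴴ * η * K i)
          + Tᴴ * ((K i)ᴴ * K i) * T := by
      intro i
      simp only [Matrix.conjTranspose_sub, Matrix.conjTranspose_mul, Matrix.sub_mul,
        Matrix.mul_sub, Matrix.mul_assoc]
      abel
    simp only [expand, Finset.sum_add_distrib, Finset.sum_sub_distrib, ← Matrix.sum_mul,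
      ← Matrix.mul_sum, smul_add, smul_sub]
    rw [← Matrix.smul_mul, ← Matrix.mul_smul, ← Matrix.smul_mul, ← Matrix.mul_smul, hK, ← hT,
      ← hT']
    simp
  rw [key]
  exact (Matrix.posSemidef_sum _ fun i _ => Matrix.posSemidef_conjTranspose_mul_self _).smul hc

/-- The Kraus form of the vertex-model loop operator. -/
theorem loopS_eq_kraus {X Y : Type*} [Fintype X] [Fintype Y]
    (U : Matrix (X × Y) (X × Y) ℂ) (η : Matrix Y Y ℂ) :
    loopS U η = (Fintype.card X : ℂ)⁻¹ • ∑ p : X × X,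
      (U.submatrix (Prod.mk p.1) (Prod.mk p.2))ᵀᴴ * η *
        (U.submatrix (Prod.mk p.1) (Prod.mk p.2))ᵀ := by
  ext y y'
  simp [loopS, Matrix.sum_apply, Matrix.mul_apply, Fintype.sum_prod_type, Finset.sum_mul]

/-- The vertex-model loop operator associated to a unitary is unital, in Kraus form. -/
theorem kraus_unital {X Y : Type*} [Fintype X] [Fintype Y] [DecidableEq X]
    [DecidableEq Y] [Nonempty X] (U : Matrix (X × Y) (X × Y) ℂ)
    (hU : U ∈ Matrix.unitaryGroup (X × Y) ℂ) :
    (Fintype.card X : ℂ)⁻¹ • ∑ p : X × X,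
      (U.submatrix (Prod.mk p.1) (Prod.mk p.2))ᵀᴴ *
        (U.submatrix (Prod.mk p.1) (Prod.mk p.2))ᵀ = 1 := by
  ext y y'
  have row : ∀ x : X, ∑ x₂, ∑ y₂, star (U (x, y) (x₂, y₂)) * U (x, y') (x₂, y₂) =
      (1 : Matrix Y Y ℂ) y y' := by
    intro x
    have h := congrFun₂ (Matrix.mem_unitaryGroup_iff.mp hU) (x, y') (x, y)
    simp only [Matrix.mul_apply, Matrix.star_apply, Fintype.sum_prod_type, Matrix.one_apply,
      Prod.mk.injEq, true_and] at h
    simpa only [mul_comm, Matrix.one_apply, eq_comm] using h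
  simp only [Matrix.smul_apply, Matrix.sum_apply, Matrix.mul_apply, Fintype.sum_prod_type,
    Matrix.conjTranspose_apply, Matrix.transpose_apply, Matrix.submatrix_apply, row]
  simp

/-- The vertex-model loop operator associated to a unitary `U`
satisfies the Kadison–Schwarz inequality: `S (ηᴴ * η) - (S η)ᴴ * (S η)` is positive
semidefinite. -/
theorem loopS_kadison_schwarz {X Y : Type*} [Fintype X] [Fintype Y] [DecidableEq X]
    [DecidableEq Y] [Nonempty X] [Nonempty Y] (U : Matrix (X × Y) (X × Y) ℂ)
    (hU : U ∈ Matrix.unitaryGroup (X × Y) ℂ) (η : Matrix Y Y ℂ) :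
    (loopS U (ηᴴ * η) - (loopS U η)ᴴ * loopS U η).PosSemidef := by
  simp only [loopS_eq_kraus]
  exact posSemidef_kraus_kadison_schwarz _ (inv_nonneg.mpr (Nat.cast_nonneg _)) _
    (kraus_unital U hU) η
end

section
/- Let X and Y be nonempty finite sets and U a unitary complex matrix indexed by X × Y. The vertex-model loop operator S on M_Y(ℂ) associated to U is a contraction for the operator norm: for every η ∈ M_Y(ℂ), ‖Sη‖ ≤ ‖η‖, where ‖·‖ denotes the operator norm of a matrix acting on ℓ²(Y). -/
open scoped Matrix

open scoped Matrix.Norms.L2Operator in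
/-- Amplifying a matrix to `ℓ²(X × Y)` does not increase its operator norm. -/
theorem l2_opNorm_one_kronecker_le {X Y : Type*} [Fintype X] [Fintype Y] [DecidableEq X]
    [DecidableEq Y] (η : Matrix Y Y ℂ) :
    ‖Matrix.kroneckerMap (· * ·) (1 : Matrix X X ℂ) η‖ ≤ ‖η‖ := by
  rw [← Matrix.l2_opNorm_toEuclideanCLM (𝕜 := ℂ)]
  refine ContinuousLinearMap.opNorm_le_bound _ (norm_nonneg _) fun v => ?_
  refine le_of_sq_le_sq ?_ (by positivity)
  rw [mul_pow, EuclideanSpace.norm_sq_eq, EuclideanSpace.norm_sq_eq, Fintype.sum_prod_type,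
    Fintype.sum_prod_type, Finset.mul_sum]
  refine Finset.sum_le_sum fun x _ => ?_
  have h := pow_le_pow_left₀ (norm_nonneg _)
    (Matrix.l2_opNorm_mulVec η (WithLp.toLp 2 fun y => v (x, y))) 2
  rw [mul_pow, EuclideanSpace.norm_sq_eq, EuclideanSpace.norm_sq_eq] at h
  refine le_trans (le_of_eq ?_) h
  refine Finset.sum_congr rfl fun y _ => ?_
  congr 2
  simp [Matrix.mulVec, dotProduct, Fintype.sum_prod_type, Matrix.one_apply]

open scoped Matrix.Norms.L2Operator in
/-- A matrix with orthonormal rows has operator norm at most one. -/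
theorem l2_opNorm_le_one_of_mul_conjTranspose_eq_one {m n : Type*} [Fintype m] [Fintype n]
    [DecidableEq m] [DecidableEq n] {W : Matrix m n ℂ} (hW : W * Wᴴ = 1) : ‖W‖ ≤ 1 := by
  have h := Matrix.l2_opNorm_conjTranspose_mul_self Wᴴ
  rw [Matrix.conjTranspose_conjTranspose, hW, Matrix.l2_opNorm_conjTranspose,
    ← Matrix.diagonal_one, Matrix.l2_opNorm_diagonal] at h
  have h1 : ‖(fun _ => 1 : m → ℂ)‖ ≤ 1 :=
    (pi_norm_le_iff_of_nonneg zero_le_one).2 fun _ => by simp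
  nlinarith [norm_nonneg W]

/-- The loop operator is an average over `X` of compressions of the amplification of `η`. -/
theorem loopS_eq_average {X Y : Type*} [Fintype X] [Fintype Y] [DecidableEq X]
    (U : Matrix (X × Y) (X × Y) ℂ) (η : Matrix Y Y ℂ) :
    loopS U η = (Fintype.card X : ℂ)⁻¹ • ∑ x : X,
      (U.map star).submatrix (Prod.mk x) id *
        Matrix.kroneckerMap (· * ·) (1 : Matrix X X ℂ) η *
          ((U.map star).submatrix (Prod.mk x) id)ᴴ := by
  ext y y'
  simp only [loopS, Matrix.of_apply, Matrix.smul_apply, Matrix.sum_apply, smul_eq_mul]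
  congr 1
  refine Finset.sum_congr rfl fun x _ => ?_
  simp [Matrix.mul_apply, Fintype.sum_prod_type, Matrix.one_apply, Finset.sum_mul]

/-- The vertex-model loop operator associated to a unitary `U` is a
contraction for the operator norm of matrices acting on `ℓ²(Y)`. -/
theorem loopS_opNorm_contraction {X Y : Type*} [Fintype X] [Fintype Y] [DecidableEq X]
    [DecidableEq Y] [Nonempty X] [Nonempty Y] (U : Matrix (X × Y) (X × Y) ℂ)
    (hU : U ∈ Matrix.unitaryGroup (X × Y) ℂ) (η : Matrix Y Y ℂ) :
    ‖Matrix.toEuclideanCLM (𝕜 := ℂ) (loopS U η)‖ ≤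
      ‖Matrix.toEuclideanCLM (𝕜 := ℂ) η‖ := by
  open scoped Matrix.Norms.L2Operator in
  rw [Matrix.l2_opNorm_toEuclideanCLM, Matrix.l2_opNorm_toEuclideanCLM, loopS_eq_average,
    norm_smul, norm_inv, Complex.norm_natCast]
  have hW (x : X) : ‖(U.map star).submatrix (Prod.mk x) id‖ ≤ 1 := by
    refine l2_opNorm_le_one_of_mul_conjTranspose_eq_one ?_
    ext y y'
    have h := congrArg star
      (congrFun (congrFun (Matrix.mem_unitaryGroup_iff.1 hU) (x, y)) (x, y'))
    rw [Matrix.star_eq_conjTranspose] at h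
    simpa [Matrix.mul_apply, Matrix.one_apply, apply_ite] using h
  have hterm (x : X) : ‖(U.map star).submatrix (Prod.mk x) id *
      Matrix.kroneckerMap (· * ·) (1 : Matrix X X ℂ) η *
        ((U.map star).submatrix (Prod.mk x) id)ᴴ‖ ≤ 1 * ‖η‖ * 1 := by
    refine (Matrix.l2_opNorm_mul _ _).trans ?_
    rw [Matrix.l2_opNorm_conjTranspose]
    gcongr
    · refine (Matrix.l2_opNorm_mul _ _).trans ?_
      gcongr
      · exact hW x
      · exact l2_opNorm_one_kronecker_le η
    · exact hW x
  rw [inv_mul_le_iff₀ (by exact_mod_cast Fintype.card_pos)]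
  simpa using norm_sum_le_of_le Finset.univ fun x _ => hterm x
end

section
/- Let X and Y be nonempty finite sets and U a unitary complex matrix indexed by X × Y. The vertex-model loop operator S on M_Y(ℂ) associated to U is a contraction for the Frobenius norm: for every η ∈ M_Y(ℂ), trace((Sη)ᴴ·(Sη)) ≤ trace(ηᴴ·η). -/
open scoped Matrix ComplexOrder

open scoped Kronecker in
/-- The loop operator is the normalized partial trace over `X` of the conjugate of `1 ⊗ η`
by the entrywise conjugate of `U`. -/
lemma loopS_apply_eq_partialTrace {X Y : Type*} [Fintype X] [Fintype Y] [DecidableEq X]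
    (U : Matrix (X × Y) (X × Y) ℂ) (η : Matrix Y Y ℂ) (y y' : Y) :
    loopS U η y y' = (Fintype.card X : ℂ)⁻¹ *
      ∑ x : X, (Uᴴᵀ * ((1 : Matrix X X ℂ) ⊗ₖ η) * Uᵀ) (x, y) (x, y') := by
  simp only [loopS, Matrix.of_apply]
  congr 1
  refine Finset.sum_congr rfl fun x _ => ?_
  simp [Matrix.mul_apply, Fintype.sum_prod_type, Matrix.one_apply, Finset.sum_mul]

lemma trace_conjTranspose_mul_self_eq_sum_norm_sq {m n : Type*} [Fintype m] [Fintype n]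
    (A : Matrix m n ℂ) :
    (Aᴴ * A).trace = ((∑ i, ∑ j, ‖A i j‖ ^ 2 : ℝ) : ℂ) := by
  rw [Finset.sum_comm]
  simp [Matrix.trace, Matrix.mul_apply, Complex.conj_mul']

lemma trace_conjTranspose_mul_self_conj {m : Type*} [Fintype m] [DecidableEq m]
    {V : Matrix m m ℂ} (hV : Vᴴ * V = 1) (A : Matrix m m ℂ) :
    ((V * A * Vᴴ)ᴴ * (V * A * Vᴴ)).trace = (Aᴴ * A).trace := by
  have h : (V * A * Vᴴ)ᴴ * (V * A * Vᴴ) = V * (Aᴴ * (Vᴴ * V) * A * Vᴴ) := by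
    simp only [Matrix.conjTranspose_mul, Matrix.conjTranspose_conjTranspose, Matrix.mul_assoc]
  rw [h, hV, Matrix.trace_mul_comm, Matrix.mul_assoc, hV, Matrix.mul_one, Matrix.mul_one]

/-- The normalized partial trace contracts the Frobenius norm up to the factor `|X|⁻¹`. -/
lemma sum_norm_sq_partialTrace_le {X Y : Type*} [Fintype X] [Fintype Y]
    (W : Matrix (X × Y) (X × Y) ℂ) :
    ∑ y, ∑ y', ‖∑ x, W (x, y) (x, y')‖ ^ 2 ≤ Fintype.card X * ∑ i, ∑ j, ‖W i j‖ ^ 2 := by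
  have h (y y' : Y) : ‖∑ x, W (x, y) (x, y')‖ ^ 2 ≤
      Fintype.card X * ∑ x, ‖W (x, y) (x, y')‖ ^ 2 :=
    (pow_le_pow_left₀ (norm_nonneg _) (norm_sum_le _ _) 2).trans sq_sum_le_card_mul_sum_sq
  calc ∑ y, ∑ y', ‖∑ x, W (x, y) (x, y')‖ ^ 2
      ≤ ∑ y, ∑ y', Fintype.card X * ∑ x, ‖W (x, y) (x, y')‖ ^ 2 :=
        Finset.sum_le_sum fun y _ => Finset.sum_le_sum fun y' _ => h y y'
    _ = Fintype.card X * ∑ x, ∑ y, ∑ y', ‖W (x, y) (x, y')‖ ^ 2 := by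
        simp_rw [← Finset.mul_sum]
        congr 1
        rw [Finset.sum_comm (s := (Finset.univ : Finset X))]
        exact Finset.sum_congr rfl fun y _ => Finset.sum_comm
    _ ≤ Fintype.card X * ∑ i, ∑ j, ‖W i j‖ ^ 2 := by
        simp only [Fintype.sum_prod_type]
        gcongr with x _ y _
        exact Finset.single_le_sum (f := fun x' => ∑ y', ‖W (x, y) (x', y')‖ ^ 2)
          (fun _ _ => by positivity) (Finset.mem_univ x)

open scoped Kronecker in
lemma sum_norm_sq_conj_one_kronecker {X Y : Type*} [Fintype X] [Fintype Y] [DecidableEq X]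
    [DecidableEq Y] {U : Matrix (X × Y) (X × Y) ℂ} (hU : U ∈ Matrix.unitaryGroup (X × Y) ℂ)
    (η : Matrix Y Y ℂ) :
    ∑ i, ∑ j, ‖(Uᴴᵀ * ((1 : Matrix X X ℂ) ⊗ₖ η) * Uᵀ) i j‖ ^ 2 =
      Fintype.card X * ∑ i, ∑ j, ‖η i j‖ ^ 2 := by
  have hVt : (Uᴴᵀ)ᴴ = Uᵀ := by ext; simp
  have hV : (Uᴴᵀ)ᴴ * Uᴴᵀ = 1 := by
    have h : Uᴴ * U = 1 := Matrix.mem_unitaryGroup_iff'.mp hU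
    rw [hVt, ← Matrix.transpose_mul, h, Matrix.transpose_one]
  have hW := trace_conjTranspose_mul_self_conj hV ((1 : Matrix X X ℂ) ⊗ₖ η)
  rw [hVt, Matrix.conjTranspose_kronecker, ← Matrix.mul_kronecker_mul,
    Matrix.trace_kronecker, Matrix.conjTranspose_one, Matrix.mul_one, Matrix.trace_one,
    trace_conjTranspose_mul_self_eq_sum_norm_sq,
    trace_conjTranspose_mul_self_eq_sum_norm_sq] at hW
  exact_mod_cast hW

/-- The vertex-model loop operator associated to a unitary `U` is a
contraction for the Frobenius norm: `trace ((S η)ᴴ * (S η)) ≤ trace (ηᴴ * η)`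
(an inequality of complex numbers with respect to the complex order). -/
theorem loopS_frobenius_contraction {X Y : Type*} [Fintype X] [Fintype Y] [DecidableEq X]
    [DecidableEq Y] [Nonempty X] [Nonempty Y] (U : Matrix (X × Y) (X × Y) ℂ)
    (hU : U ∈ Matrix.unitaryGroup (X × Y) ℂ) (η : Matrix Y Y ℂ) :
    ((loopS U η)ᴴ * loopS U η).trace ≤ (ηᴴ * η).trace := by
  have hcard : (0 : ℝ) < Fintype.card X := by exact_mod_cast Fintype.card_pos
  have hle := sum_norm_sq_partialTrace_le _ |>.trans_eq
    (congrArg _ (sum_norm_sq_conj_one_kronecker hU η))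
  rw [trace_conjTranspose_mul_self_eq_sum_norm_sq, trace_conjTranspose_mul_self_eq_sum_norm_sq,
    Complex.real_le_real]
  simp only [loopS_apply_eq_partialTrace, norm_mul, mul_pow, ← Finset.mul_sum, norm_inv,
    Complex.norm_natCast]
  rw [inv_pow, inv_mul_le_iff₀ (pow_pos hcard 2)]
  exact hle.trans_eq (by ring)
end

section
/- Let X and Y be nonempty finite sets and U a unitary complex matrix indexed by X × Y, with vertex-model loop operator S on M_Y(ℂ). Then every bounded S-harmonic sequence of matrices lies in the ℂ-linear span of the elementary sequences k ↦ λ^{-k} • η, where λ ranges over the eigenvalues of S with |λ| = 1 and η ∈ M_Y(ℂ) over corresponding eigenvectors (Sη = λ·η). -/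
open scoped Matrix

/-- Bounded sequences `η` with `S (η (k + 1)) = η k`. -/
def boundedHarmonic {V : Type*} [NormedAddCommGroup V] [NormedSpace ℂ V]
    (S : Module.End ℂ V) : Submodule ℂ (ℕ → V) where
  carrier := {η | (∀ k, S (η (k + 1)) = η k) ∧ ∃ C : ℝ, ∀ k, ‖η k‖ ≤ C}
  zero_mem' := ⟨by simp, 0, by simp⟩
  add_mem' := by
    rintro a b ⟨ha, C, hC⟩ ⟨hb, D, hD⟩
    exact ⟨fun k => by simp [ha, hb], C + D,
      fun k => (norm_add_le _ _).trans (add_le_add (hC k) (hD k))⟩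
  smul_mem' := by
    rintro c a ⟨ha, C, hC⟩
    refine ⟨fun k => by simp [ha], ‖c‖ * C, fun k => ?_⟩
    rw [Pi.smul_apply, norm_smul]
    exact mul_le_mul_of_nonneg_left (hC k) (norm_nonneg c)

section Contraction

variable {V : Type*} [NormedAddCommGroup V] [NormedSpace ℂ V] {S : Module.End ℂ V}

lemma pow_apply_harmonic {η : ℕ → V} (h : ∀ k, S (η (k + 1)) = η k) (n k : ℕ) :
    (S ^ n) (η (k + n)) = η k := by
  induction n with
  | zero => simp
  | succ n ih => rw [pow_succ, Module.End.mul_apply, ← add_assoc, h, ih]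

/-- A harmonic sequence is determined by its initial term. -/
lemma harmonic_eq_zero [FiniteDimensional ℂ V] {η : ℕ → V}
    (h : ∀ k, S (η (k + 1)) = η k) (h0 : η 0 = 0) : η = 0 := by
  funext k
  have hk : (S ^ (k + Module.finrank ℂ V)) (η (k + Module.finrank ℂ V)) = 0 := by
    simpa [h0] using pow_apply_harmonic h (k + Module.finrank ℂ V) 0
  have := Module.End.ker_pow_eq_ker_pow_finrank_of_le
    (f := S) (Nat.le_add_left (Module.finrank ℂ V) k)
  rw [← LinearMap.mem_ker, this, LinearMap.mem_ker, pow_apply_harmonic h] at hk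
  exact hk

/-- A contraction acts termwise on its bounded harmonic sequences. -/
def harmonicEnd (hS : ∀ v, ‖S v‖ ≤ ‖v‖) : Module.End ℂ (boundedHarmonic S) :=
  (S.compLeft ℕ).restrict (p := boundedHarmonic S) (q := boundedHarmonic S) <| by
    rintro η ⟨h, C, hC⟩
    exact ⟨fun k => by simp [h], C, fun k => (hS _).trans (hC k)⟩

lemma harmonicEnd_apply (hS : ∀ v, ‖S v‖ ≤ ‖v‖) (η : boundedHarmonic S) (k : ℕ) :
    (harmonicEnd hS η : ℕ → V) k = S (η.1 k) := rfl

instance [FiniteDimensional ℂ V] : FiniteDimensional ℂ (boundedHarmonic S) := by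
  refine FiniteDimensional.of_injective
    ((LinearMap.proj (R := ℂ) (φ := fun _ : ℕ => V) 0).comp (boundedHarmonic S).subtype) ?_
  rw [← LinearMap.ker_eq_bot, LinearMap.ker_eq_bot']
  intro η hη
  exact Subtype.ext (harmonic_eq_zero η.2.1 hη)

lemma eq_inv_pow_smul_of_eigen {η : ℕ → V} (h : ∀ k, S (η (k + 1)) = η k)
    {l : ℂ} (hl : l ≠ 0) (he : ∀ k, S (η k) = l • η k) (k : ℕ) :
    η k = l⁻¹ ^ k • η 0 := by
  induction k with
  | zero => simp
  | succ k ih =>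
    rw [pow_succ', mul_smul, ← ih, ← h k, he, inv_smul_smul₀ hl]

/-- An eigenvalue of a contraction carried by a nonzero bounded harmonic sequence is unimodular. -/
lemma norm_eq_one_of_eigen (hS : ∀ v, ‖S v‖ ≤ ‖v‖) {η : ℕ → V} (hη : η ∈ boundedHarmonic S)
    {l : ℂ} (he : ∀ k, S (η k) = l • η k) (hne : η ≠ 0) : ‖l‖ = 1 := by
  obtain ⟨h, C, hC⟩ := hη
  have hl : l ≠ 0 := by
    rintro rfl
    exact hne (funext fun k => by rw [← h k, he]; simp)
  have hpow := eq_inv_pow_smul_of_eigen h hl he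
  have h0 : 0 < ‖η 0‖ := by
    rw [norm_pos_iff]
    intro h0
    exact hne (funext fun k => by rw [hpow, h0]; simp)
  apply le_antisymm
  · have := hS (η 0)
    rw [he, norm_smul] at this
    exact le_of_mul_le_mul_right (by simpa using this) h0
  · by_contra! hlt
    have hinv : 1 < ‖l‖⁻¹ := (one_lt_inv₀ (norm_pos_iff.2 hl)).2 hlt
    obtain ⟨n, hn⟩ := pow_unbounded_of_one_lt (C / ‖η 0‖) hinv
    have := hC n
    rw [hpow, norm_smul, norm_pow, norm_inv] at this
    rw [div_lt_iff₀ h0] at hn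
    exact absurd this (not_le.2 hn)

/-- A contraction has no nontrivial Jordan block at a unimodular eigenvalue. -/
lemma eq_zero_of_jordan (hS : ∀ v, ‖S v‖ ≤ ‖v‖) {l : ℂ} (hl : ‖l‖ = 1) {v w : V}
    (hv : S v = l • v + w) (hw : S w = l • w) : w = 0 := by
  have hl0 : l ≠ 0 := norm_ne_zero_iff.1 (by simp [hl])
  have key (n : ℕ) : (S ^ n) v = l ^ n • v + ((n : ℂ) * l ^ n * l⁻¹) • w := by
    induction n with
    | zero => simp
    | succ n ih =>
      rw [pow_succ', Module.End.mul_apply, ih, map_add, map_smul, map_smul, hv, hw]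
      match_scalars <;> field_simp <;> ring
  have hpow (n : ℕ) : ‖(S ^ n) v‖ ≤ ‖v‖ := by
    induction n with
    | zero => simp
    | succ n ih => rw [pow_succ', Module.End.mul_apply]; exact (hS _).trans ih
  by_contra hne
  obtain ⟨n, hn⟩ := exists_nat_gt (2 * ‖v‖ / ‖w‖)
  rw [div_lt_iff₀ (norm_pos_iff.2 hne)] at hn
  have h1 : ((n : ℂ) * l ^ n * l⁻¹) • w = (S ^ n) v - l ^ n • v := by rw [key]; abel
  have h2 : (n : ℝ) * ‖w‖ = ‖(S ^ n) v - l ^ n • v‖ := by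
    rw [← h1]; simp [norm_smul, hl]
  have h3 := norm_sub_le ((S ^ n) v) (l ^ n • v)
  rw [norm_smul, norm_pow, hl, one_pow, one_mul] at h3
  linarith [hpow n]

lemma harmonicEnd_mem_eigenspace (hS : ∀ v, ‖S v‖ ≤ ‖v‖) (l : ℂ) (n : ℕ) :
    ∀ η : boundedHarmonic S, ((harmonicEnd hS - algebraMap ℂ _ l) ^ n) η = 0 →
      (harmonicEnd hS) η = l • η := by
  induction n with
  | zero => intro η hη; simp_all
  | succ n ih =>
    intro η hη
    rw [pow_succ, Module.End.mul_apply] at hη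
    set ξ : boundedHarmonic S := (harmonicEnd hS - algebraMap ℂ _ l) η with hξ
    have hξe := ih ξ hη
    have hηe : harmonicEnd hS η = l • η + ξ := by
      rw [hξ]; simp [Module.algebraMap_end_apply]
    suffices ξ = 0 by rw [hηe, this, add_zero]
    by_contra hne
    have he (k : ℕ) : S (ξ.1 k) = l • ξ.1 k := by
      rw [← harmonicEnd_apply hS, hξe]; rfl
    have hl := norm_eq_one_of_eigen hS ξ.2 he (fun h => hne (Subtype.ext h))
    refine hne (Subtype.ext (funext fun k => ?_))
    refine eq_zero_of_jordan hS hl (v := η.1 k) ?_ (he k)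
    rw [← harmonicEnd_apply hS, hηe]; rfl

/-- Bounded harmonic sequences of a contraction of a finite-dimensional space are spanned by the
elementary ones. -/
theorem boundedHarmonic_le_span [FiniteDimensional ℂ V] (hS : ∀ v, ‖S v‖ ≤ ‖v‖) :
    boundedHarmonic S ≤ Submodule.span ℂ
      {s : ℕ → V | ∃ (l : ℂ) (κ : V), ‖l‖ = 1 ∧ S κ = l • κ ∧ s = fun k : ℕ => l⁻¹ ^ k • κ} := by
  set E := Submodule.span ℂ
    {s : ℕ → V | ∃ (l : ℂ) (κ : V), ‖l‖ = 1 ∧ S κ = l • κ ∧ s = fun k : ℕ => l⁻¹ ^ k • κ}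
  suffices ⊤ ≤ E.comap (boundedHarmonic S).subtype from
    fun η hη => this (Submodule.mem_top (x := ⟨η, hη⟩))
  rw [← Module.End.iSup_maxGenEigenspace_eq_top (harmonicEnd hS)]
  refine iSup_le fun l η hη => ?_
  obtain ⟨n, hn⟩ := (Module.End.mem_maxGenEigenspace _ _ _).1 hη
  have hηe := harmonicEnd_mem_eigenspace hS l n η hn
  have he (k : ℕ) : S (η.1 k) = l • η.1 k := by
    rw [← harmonicEnd_apply hS, hηe]; rfl
  rw [Submodule.mem_comap, Submodule.subtype_apply]
  by_cases hne : η.1 = 0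
  · rw [hne]; exact E.zero_mem
  have hl := norm_eq_one_of_eigen hS η.2 he hne
  exact Submodule.subset_span ⟨l, η.1 0, hl, he 0, funext fun k =>
    eq_inv_pow_smul_of_eigen η.2.1 (norm_ne_zero_iff.1 (by simp [hl])) he k⟩

end Contraction

open scoped Kronecker

lemma trace_mul_conjTranspose_eq_sum_norm_sq {m : Type*} [Fintype m] (A : Matrix m m ℂ) :
    (A * Aᴴ).trace = ((∑ i, ∑ j, ‖A i j‖ ^ 2 : ℝ) : ℂ) := by
  simp [Matrix.trace, Matrix.mul_apply, Complex.mul_conj']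

/-- The loop operator is a normalised partial trace of a conjugation. -/
lemma loopS_apply_eq_sum {X Y : Type*} [Fintype X] [Fintype Y] [DecidableEq X]
    (U : Matrix (X × Y) (X × Y) ℂ) (η : Matrix Y Y ℂ) (y y' : Y) :
    loopS U η y y' = (Fintype.card X : ℂ)⁻¹ *
      ∑ x, (Uᴴᵀ * ((1 : Matrix X X ℂ) ⊗ₖ η) * (Uᴴᵀ)ᴴ) (x, y) (x, y') := by
  simp only [loopS, Matrix.of_apply, Matrix.mul_apply, Fintype.sum_prod_type,
    Matrix.kroneckerMap_apply, Matrix.transpose_apply, Matrix.conjTranspose_apply,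
    Matrix.one_apply, Finset.sum_mul, ite_mul, mul_ite, one_mul, zero_mul, mul_zero]
  congr 1
  refine Finset.sum_congr rfl fun x _ => Finset.sum_congr rfl fun x₂ _ =>
    Finset.sum_congr rfl fun y₁ _ => ?_
  rw [Finset.sum_comm]
  simp

/-- The loop operator is a contraction for the Hilbert–Schmidt norm. -/
lemma sum_norm_sq_loopS_le {X Y : Type*} [Fintype X] [Fintype Y]
    [DecidableEq X] [DecidableEq Y] [Nonempty X]
    {U : Matrix (X × Y) (X × Y) ℂ} (hU : U ∈ Matrix.unitaryGroup (X × Y) ℂ) (η : Matrix Y Y ℂ) :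
    ∑ y, ∑ y', ‖loopS U η y y'‖ ^ 2 ≤ ∑ y, ∑ y', ‖η y y'‖ ^ 2 := by
  set W := Uᴴᵀ
  set K := (1 : Matrix X X ℂ) ⊗ₖ η
  set M := W * K * Wᴴ with hM
  have hW : Wᴴ * W = 1 := by
    have h1 : U * Uᴴ = 1 := Matrix.mem_unitaryGroup_iff.1 hU
    have h2 : Wᴴ = Uᵀ := by ext; simp [W]
    rw [h2, ← Matrix.transpose_mul, mul_eq_one_comm.1 h1, Matrix.transpose_one]
  have htr : (M * Mᴴ).trace = (Fintype.card X : ℂ) * (η * ηᴴ).trace := by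
    have h1 : M * Mᴴ = W * (K * Kᴴ) * Wᴴ := by
      rw [hM, Matrix.conjTranspose_mul, Matrix.conjTranspose_mul, Matrix.conjTranspose_conjTranspose]
      calc W * K * Wᴴ * (W * (Kᴴ * Wᴴ)) = W * K * (Wᴴ * W) * (Kᴴ * Wᴴ) := by
            simp only [Matrix.mul_assoc]
        _ = _ := by rw [hW]; simp only [Matrix.mul_assoc, Matrix.one_mul]
    rw [h1, Matrix.trace_mul_cycle, hW, Matrix.one_mul, Matrix.conjTranspose_kronecker,
      ← Matrix.mul_kronecker_mul, Matrix.trace_kronecker]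
    simp
  rw [trace_mul_conjTranspose_eq_sum_norm_sq, trace_mul_conjTranspose_eq_sum_norm_sq] at htr
  have hMη : ∑ i, ∑ j, ‖M i j‖ ^ 2 = (Fintype.card X : ℝ) * ∑ y, ∑ y', ‖η y y'‖ ^ 2 := by
    exact_mod_cast htr
  have hc : (0 : ℝ) < Fintype.card X := by exact_mod_cast Fintype.card_pos
  have hle (y y' : Y) : ‖loopS U η y y'‖ ^ 2 ≤
      (Fintype.card X : ℝ)⁻¹ * ∑ x, ‖M (x, y) (x, y')‖ ^ 2 := by
    rw [loopS_apply_eq_sum, norm_mul, mul_pow, norm_inv, Complex.norm_natCast]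
    have h1 : ‖∑ x, M (x, y) (x, y')‖ ^ 2 ≤
        (Fintype.card X : ℝ) * ∑ x, ‖M (x, y) (x, y')‖ ^ 2 :=
      (pow_le_pow_left₀ (norm_nonneg _) (norm_sum_le _ _) 2).trans
        sq_sum_le_card_mul_sum_sq
    calc _ ≤ (Fintype.card X : ℝ)⁻¹ ^ 2 *
          ((Fintype.card X : ℝ) * ∑ x, ‖M (x, y) (x, y')‖ ^ 2) := by gcongr
      _ = _ := by field_simp
  have hdiag : ∑ y, ∑ y', ∑ x, ‖M (x, y) (x, y')‖ ^ 2 ≤ ∑ i, ∑ j, ‖M i j‖ ^ 2 := by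
    simp only [Fintype.sum_prod_type]
    calc _ = ∑ x, ∑ y, ∑ y', ‖M (x, y) (x, y')‖ ^ 2 :=
          (Finset.sum_congr rfl fun _ _ => Finset.sum_comm).trans Finset.sum_comm
      _ ≤ _ := Finset.sum_le_sum fun x _ => Finset.sum_le_sum fun y _ =>
          Finset.single_le_sum (f := fun x₂ => ∑ y', ‖M (x, y) (x₂, y')‖ ^ 2)
            (fun _ _ => by positivity) (Finset.mem_univ x)
  calc _ ≤ ∑ y, ∑ y', (Fintype.card X : ℝ)⁻¹ * ∑ x, ‖M (x, y) (x, y')‖ ^ 2 :=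
        Finset.sum_le_sum fun y _ => Finset.sum_le_sum fun y' _ => hle y y'
    _ = (Fintype.card X : ℝ)⁻¹ * ∑ y, ∑ y', ∑ x, ‖M (x, y) (x, y')‖ ^ 2 := by
        simp only [Finset.mul_sum]
    _ ≤ (Fintype.card X : ℝ)⁻¹ * ((Fintype.card X : ℝ) * ∑ y, ∑ y', ‖η y y'‖ ^ 2) := by
        rw [← hMη]; gcongr
    _ = _ := by field_simp

/-- `loopS U` as a linear map. -/
noncomputable def loopSEnd {X Y : Type*} [Fintype X] [Fintype Y]
    (U : Matrix (X × Y) (X × Y) ℂ) : Module.End ℂ (Matrix Y Y ℂ) where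
  toFun := loopS U
  map_add' a b := by
    ext y y'
    simp only [loopS, Matrix.of_apply, Matrix.add_apply, mul_add, add_mul, Finset.sum_add_distrib]
  map_smul' c a := by
    ext y y'
    simp only [loopS, Matrix.of_apply, Matrix.smul_apply, smul_eq_mul, RingHom.id_apply,
      Finset.mul_sum]
    refine Finset.sum_congr rfl fun _ _ => Finset.sum_congr rfl fun _ _ =>
      Finset.sum_congr rfl fun _ _ => Finset.sum_congr rfl fun _ _ => by ring

/-- Every bounded harmonic sequence for the vertex-model loop operator
`S = loopS U` of a unitary `U` lies in the `ℂ`-span of the elementary sequences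
`k ↦ λ⁻ᵏ • η` where `‖λ‖ = 1` and `S η = λ • η`. -/
theorem loopS_bounded_harmonic_mem_span {X Y : Type*} [Fintype X] [Fintype Y]
    [DecidableEq X] [DecidableEq Y] [Nonempty X] [Nonempty Y]
    (U : Matrix (X × Y) (X × Y) ℂ) (hU : U ∈ Matrix.unitaryGroup (X × Y) ℂ)
    (η : ℕ → Matrix Y Y ℂ) (hharm : ∀ k : ℕ, loopS U (η (k + 1)) = η k)
    (hbdd : ∃ C : ℝ, ∀ (k : ℕ) (y y' : Y), ‖η k y y'‖ ≤ C) :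
    η ∈ Submodule.span ℂ
      {s : ℕ → Matrix Y Y ℂ |
        ∃ (l : ℂ) (κ : Matrix Y Y ℂ), ‖l‖ = 1 ∧ loopS U κ = l • κ ∧
          s = fun k : ℕ => l⁻¹ ^ k • κ} := by
  let := Matrix.frobeniusNormedAddCommGroup (m := Y) (n := Y) (α := ℂ)
  let := Matrix.frobeniusNormedSpace (R := ℂ) (m := Y) (n := Y) (α := ℂ)
  have hnorm (A : Matrix Y Y ℂ) : ‖A‖ = (∑ y, ∑ y', ‖A y y'‖ ^ 2) ^ (1 / 2 : ℝ) := by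
    simpa using Matrix.frobenius_norm_def A
  have hS (A : Matrix Y Y ℂ) : ‖loopSEnd U A‖ ≤ ‖A‖ := by
    rw [hnorm, hnorm]
    exact Real.rpow_le_rpow (by positivity) (sum_norm_sq_loopS_le hU A) (by norm_num)
  refine boundedHarmonic_le_span (S := loopSEnd U) hS ⟨hharm, ?_⟩
  obtain ⟨C, hC⟩ := hbdd
  refine ⟨(∑ _y : Y, ∑ _y' : Y, C ^ 2) ^ (1 / 2 : ℝ), fun k => ?_⟩
  rw [hnorm]
  refine Real.rpow_le_rpow (by positivity) ?_ (by norm_num)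
  exact Finset.sum_le_sum fun y _ => Finset.sum_le_sum fun y' _ =>
    pow_le_pow_left₀ (norm_nonneg _) (hC k y y') 2
end
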